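/- arXiv:0903.1575 — 2 statements merged into one kernel-verified Lean document; each statement's English description precedes it below -/
import Mathlib

section
/- For every real number z, the improper integral lim_{R → ∞} ∫_{−R}^{R} e(t z − t²/4) dt exists and equals √2 · e^{−iπ/4} · e(z²). Equivalently, e(z²) = (e^{iπ/4}/√2) · lim_{R → ∞} ∫_{−R}^{R} e(t z − t²/4) dt. -/
open MeasureTheory Filter

/-- `e x = exp(2πix)`. -/
noncomputable def e (x : ℝ) : ℂ := Complex.exp (2 * Real.pi * Complex.I * x)

/-- The integral of a holomorphic function around the triangle with vertices
`0`, `T`, `T - T * I` vanishes. -/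
lemma integral_triangle {f : ℂ → ℂ} (hf : Differentiable ℂ f) {T : ℝ} (hT : 0 ≤ T) :
    (∫ t in (0 : ℝ)..T, f t) + (∫ s in (0 : ℝ)..T, f (T + s * -Complex.I) * -Complex.I) =
      ∫ s in (0 : ℝ)..T, f (s * (1 - Complex.I)) * (1 - Complex.I) := by
  obtain ⟨G, hG⟩ := (hf.differentiableOn (s := Metric.ball (0 : ℂ) (2 * T + 1))).isExactOn_ball
  have segment (p v : ℂ) (hpv : ∀ s ∈ Set.Icc 0 T, ‖p + s * v‖ < 2 * T + 1) :
      ∫ s in (0 : ℝ)..T, f (p + s * v) * v = G (p + T * v) - G p := by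
    have hderiv : ∀ s ∈ Set.uIcc 0 T,
        HasDerivAt (fun s : ℝ => G (p + s * v)) (f (p + s * v) * v) s := by
      intro s hs
      rw [Set.uIcc_of_le hT] at hs
      have hlin : HasDerivAt (fun s : ℝ => p + s * v) v s := by
        simpa using ((Complex.ofRealCLM.hasDerivAt (x := s)).mul_const v).const_add p
      exact (hG _ (by simpa using hpv s hs)).comp s hlin
    have hcont : Continuous fun s : ℝ => f (p + s * v) * v := by
      have := hf.continuous
      fun_prop
    simpa using intervalIntegral.integral_eq_sub_of_hasDerivAt hderiv
      (hcont.intervalIntegrable _ _)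
  have hnorm (a b : ℝ) (ha : a ∈ Set.Icc 0 T) (hb : b ∈ Set.Icc 0 T) :
      ‖(a + b * -Complex.I : ℂ)‖ < 2 * T + 1 := by
    refine (norm_add_le _ _).trans_lt ?_
    simp only [norm_mul, norm_neg, Complex.norm_I, Complex.norm_real, Real.norm_eq_abs,
      abs_of_nonneg ha.1, abs_of_nonneg hb.1]
    linarith [ha.2, hb.2]
  have h0 : (0 : ℝ) ∈ Set.Icc 0 T := ⟨le_rfl, hT⟩
  have h₁ := segment 0 1 fun s hs => by simpa using hnorm s 0 hs h0
  have h₂ := segment T (-Complex.I) fun s hs => hnorm T s ⟨hT, le_rfl⟩ hs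
  have h₃ := segment 0 (1 - Complex.I) fun s hs => by
    convert! hnorm s s hs hs using 2
    ring
  simp only [zero_add, mul_one] at h₁ h₃
  rw [h₁, h₂, h₃, show (T : ℂ) * (1 - Complex.I) = T + T * -Complex.I by ring]
  ring

/-- The half-line Fresnel integral `∫₀^∞ exp(-i c t²) dt`. -/
lemma tendsto_integral_fresnel {c : ℝ} (hc : 0 < c) :
    Tendsto (fun T : ℝ => ∫ t in (0 : ℝ)..T, Complex.exp (-(c * Complex.I) * (t : ℂ) ^ 2)) atTop
      (nhds ((Real.sqrt (Real.pi / (2 * c)) / 2 : ℝ) * (1 - Complex.I))) := by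
  set f : ℂ → ℂ := fun w => Complex.exp (-(c * Complex.I) * w ^ 2) with hf
  have hfd : Differentiable ℂ f := by fun_prop
  have hdiag (s : ℝ) : f (s * (1 - Complex.I)) = (Real.exp (-(2 * c) * s ^ 2) : ℝ) := by
    simp only [hf]
    push_cast
    congr 1
    linear_combination (2 * c * s ^ 2 - c * s ^ 2 * Complex.I : ℂ) * Complex.I_sq
  have hvert (T s : ℝ) : ‖f (T + s * -Complex.I)‖ = Real.exp (-(2 * c * T) * s) := by
    simp only [hf, Complex.norm_exp]
    congr 1
    simp [pow_two]
    ring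
  have hgauss : Tendsto (fun T : ℝ =>
      ∫ s in (0 : ℝ)..T, f (s * (1 - Complex.I)) * (1 - Complex.I)) atTop
      (nhds ((Real.sqrt (Real.pi / (2 * c)) / 2 : ℝ) * (1 - Complex.I))) := by
    simp only [hdiag, intervalIntegral.integral_mul_const, intervalIntegral.integral_ofReal]
    refine Tendsto.mul_const _ ((Complex.continuous_ofReal.tendsto _).comp ?_)
    rw [← integral_gaussian_Ioi]
    exact intervalIntegral_tendsto_integral_Ioi 0
      (integrable_exp_neg_mul_sq (by positivity)).integrableOn tendsto_id
  have hside : Tendsto (fun T : ℝ =>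
      ∫ s in (0 : ℝ)..T, f (T + s * -Complex.I) * -Complex.I) atTop (nhds 0) := by
    refine squeeze_zero_norm' (a := fun T : ℝ => (2 * c * T)⁻¹) ?_
      (tendsto_inv_atTop_zero.comp (tendsto_id.const_mul_atTop (by positivity)))
    filter_upwards [eventually_gt_atTop 0] with T hT
    have hpos : 0 < 2 * c * T := by positivity
    have hint := integrableOn_exp_mul_Ioi (neg_lt_zero.mpr hpos) 0
    calc ‖∫ s in (0 : ℝ)..T, f (T + s * -Complex.I) * -Complex.I‖
        ≤ ∫ s in (0 : ℝ)..T, Real.exp (-(2 * c * T) * s) :=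
          intervalIntegral.norm_integral_le_of_norm_le hT.le
            (.of_forall fun s _ => by simp only [norm_mul, hvert]; simp)
            (Continuous.intervalIntegrable (by fun_prop) _ _)
      _ ≤ ∫ s in Set.Ioi (0 : ℝ), Real.exp (-(2 * c * T) * s) := by
          rw [intervalIntegral.integral_of_le hT.le]
          exact setIntegral_mono_set hint (.of_forall fun _ => (Real.exp_pos _).le)
            Set.Ioc_subset_Ioi_self.eventuallyLE
      _ = (2 * c * T)⁻¹ := by
          rw [integral_exp_mul_Ioi (neg_lt_zero.mpr hpos)]
          simp [neg_div_neg_eq]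
  have hsub := hgauss.sub hside
  rw [sub_zero] at hsub
  refine hsub.congr' ?_
  filter_upwards [eventually_ge_atTop 0] with T hT
  exact sub_eq_of_eq_add (integral_triangle hfd hT).symm

/-- Completing the square in the phase `t * z - t ^ 2 / 4`. -/
lemma e_mul_sub_sq_div_four (t z : ℝ) :
    e (t * z - t ^ 2 / 4) =
      e (z ^ 2) * Complex.exp (-((Real.pi / 2 : ℝ) * Complex.I) * ((t - 2 * z : ℝ) : ℂ) ^ 2) := by
  rw [e, e, ← Complex.exp_add]
  push_cast
  congr 1
  ring

lemma sqrt_two_mul_exp_neg_I_mul_pi_div_four :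
    (Real.sqrt 2 : ℂ) * Complex.exp (-(Complex.I * Real.pi / 4)) = 1 - Complex.I := by
  have hsq : (Real.sqrt 2 : ℂ) * Real.sqrt 2 = 2 := by
    rw [← Complex.ofReal_mul, Real.mul_self_sqrt zero_le_two, Complex.ofReal_ofNat]
  rw [show -(Complex.I * Real.pi / 4) = ((-(Real.pi / 4) : ℝ) : ℂ) * Complex.I by push_cast; ring,
    Complex.exp_mul_I, ← Complex.ofReal_cos, ← Complex.ofReal_sin, Real.cos_neg, Real.sin_neg,
    Real.cos_pi_div_four, Real.sin_pi_div_four]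
  push_cast
  linear_combination (1 - Complex.I) / 2 * hsq

theorem stmt6 (z : ℝ) :
    Tendsto (fun R : ℝ => ∫ t in (-R)..R, e (t * z - t ^ 2 / 4)) atTop
      (nhds ((Real.sqrt 2 : ℂ) * Complex.exp (-(Complex.I * Real.pi / 4)) * e (z ^ 2))) := by
  set g : ℝ → ℂ := fun u => Complex.exp (-((Real.pi / 2 : ℝ) * Complex.I) * (u : ℂ) ^ 2) with hg
  have hgc : Continuous g := by fun_prop
  have hlim : Tendsto (fun T : ℝ => ∫ u in (0 : ℝ)..T, g u) atTop
      (nhds ((1 - Complex.I) / 2)) := by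
    convert tendsto_integral_fresnel Real.pi_div_two_pos using 2
    rw [mul_div_cancel₀ _ two_ne_zero, div_self Real.pi_ne_zero, Real.sqrt_one]
    push_cast
    ring
  have hsplit (R : ℝ) : ∫ t in (-R)..R, e (t * z - t ^ 2 / 4) =
      e (z ^ 2) * ((∫ u in (0 : ℝ)..(R + 2 * z), g u) + ∫ u in (0 : ℝ)..(R - 2 * z), g u) := by
    simp only [e_mul_sub_sq_div_four, intervalIntegral.integral_const_mul]
    rw [intervalIntegral.integral_comp_sub_right g (2 * z),
      ← intervalIntegral.integral_add_adjacent_intervals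
        (hgc.intervalIntegrable (-R - 2 * z) 0) (hgc.intervalIntegrable 0 (R - 2 * z))]
    have heven := intervalIntegral.integral_comp_neg (a := 0) (b := R + 2 * z) g
    rw [neg_zero, neg_add', show (fun u => g (-u)) = g by ext; simp [hg]] at heven
    rw [heven]
  simp only [hsplit]
  rw [sqrt_two_mul_exp_neg_I_mul_pi_div_four, mul_comm _ (e _)]
  have hsum := ((hlim.comp (tendsto_atTop_add_const_right _ (2 * z) tendsto_id)).add
    (hlim.comp (tendsto_atTop_add_const_right _ (-(2 * z)) tendsto_id))).const_mul (e (z ^ 2))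
  rwa [add_halves] at hsum
end

section
/- Let w : ℝ → ℂ be a smooth compactly supported function, let Z > 0 and let v ∈ ℝ. Then ∫_ℝ e(z² − v z) w(z/Z) dz = (e^{iπ/4}/√2) · Z · ∫_ℝ e( −((v+y)/2)² ) ŵ(−y Z) dy, where ŵ(ξ) := ∫_ℝ w(t) e(−ξ t) dt. Both integrals converge absolutely. -/
open MeasureTheory

open scoped FourierTransform SchwartzMap Topology

theorem norm_e (x : ℝ) : ‖e x‖ = 1 := by
  have : (2 * Real.pi * Complex.I * x : ℂ) = ((2 * Real.pi * x : ℝ) : ℂ) * Complex.I := by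
    push_cast; ring
  rw [e, this, Complex.norm_exp_ofReal_mul_I]

theorem continuous_e : Continuous e := by
  unfold e
  fun_prop

theorem integrable_e_comp_mul {φ : ℝ → ℝ} (hφ : Continuous φ) {f : ℝ → ℂ} (hf : Integrable f) :
    Integrable fun x => e (φ x) * f x :=
  hf.bdd_mul (c := 1) (continuous_e.comp hφ).aestronglyMeasurable
    (Filter.Eventually.of_forall fun _ => (norm_e _).le)

theorem norm_cexp_neg_pi_mul_sq_add_le {b : ℂ} (hb : 0 ≤ b.re) (v x : ℝ) :
    ‖Complex.exp (-Real.pi * b * x ^ 2 + 2 * Real.pi * (-Complex.I * v) * x)‖ ≤ 1 := by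
  have h : (-Real.pi * b * x ^ 2 + 2 * Real.pi * (-Complex.I * v) * x : ℂ)
      = ((-(Real.pi * x ^ 2) : ℝ) : ℂ) * b + ((-(2 * Real.pi * v * x) : ℝ) : ℂ) * Complex.I := by
    push_cast; ring
  rw [Complex.norm_exp, Real.exp_le_one_iff, h, Complex.add_re, Complex.re_ofReal_mul,
    Complex.re_ofReal_mul, Complex.I_re]
  have : 0 ≤ Real.pi * x ^ 2 * b.re := by positivity
  linarith

theorem norm_cexp_neg_pi_div_mul_sq_le {b : ℂ} (hb : 0 ≤ b.re) (v x : ℝ) :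
    ‖Complex.exp (-Real.pi / b * (x + Complex.I * (-Complex.I * v)) ^ 2)‖ ≤ 1 := by
  have h : (-Real.pi / b * (x + Complex.I * (-Complex.I * v)) ^ 2 : ℂ)
      = ((-(Real.pi * (x + v) ^ 2) : ℝ) : ℂ) * b⁻¹ := by
    rw [show (Complex.I * (-Complex.I * v) : ℂ) = v by rw [← mul_assoc]; simp]
    push_cast; ring
  rw [Complex.norm_exp, Real.exp_le_one_iff, h, Complex.re_ofReal_mul, Complex.inv_re]
  have : 0 ≤ Real.pi * (x + v) ^ 2 * (b.re / Complex.normSq b) :=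
    mul_nonneg (by positivity) (div_nonneg hb (Complex.normSq_nonneg b))
  linarith

theorem integral_gaussian_mul_schwartz {b : ℂ} (hb : 0 < b.re) (c : ℂ) (g : 𝓢(ℝ, ℂ)) :
    ∫ z : ℝ, Complex.exp (-Real.pi * b * z ^ 2 + 2 * Real.pi * c * z) * g z
      = 1 / b ^ (1 / 2 : ℂ) *
        ∫ y : ℝ, Complex.exp (-Real.pi / b * (y + Complex.I * c) ^ 2) * 𝓕⁻ g y := by
  have hG : Integrable fun z : ℝ =>
      Complex.exp (-Real.pi * b * z ^ 2 + 2 * Real.pi * c * z) := by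
    have : 0 < (Real.pi * b).re := by
      rw [Complex.re_ofReal_mul]; exact mul_pos Real.pi_pos hb
    simpa using integrable_cexp_quadratic this (2 * Real.pi * c) 0
  have key := VectorFourier.integral_fourierIntegral_smul_eq_flip (L := innerₗ ℝ)
    (μ := volume) (ν := volume) Real.continuous_fourierChar continuous_inner
    (𝓕⁻ g).integrable hG
  rw [flip_innerₗ] at key
  change ∫ z : ℝ, 𝓕 (𝓕⁻ g) z • _ = ∫ y : ℝ, 𝓕⁻ g y • 𝓕 (fun z : ℝ =>
    Complex.exp (-Real.pi * b * z ^ 2 + 2 * Real.pi * c * z)) y at key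
  rw [FourierTransform.fourier_fourierInv_eq, fourier_gaussian_pi' hb] at key
  simp only [smul_eq_mul] at key
  rw [← integral_const_mul]
  calc _ = _ := by simp_rw [mul_comm _ (g _)]
    _ = _ := key
    _ = _ := by congr 1; ext y; ring

/-- The pairing of a Gaussian with a Schwartz function, up to the boundary of the half-plane of
admissible Gaussian parameters. -/
theorem integral_gaussian_mul_schwartz_of_re_nonneg {b : ℂ} (hb : 0 ≤ b.re) (hb0 : b ≠ 0)
    (v : ℝ) (g : 𝓢(ℝ, ℂ)) :
    ∫ z : ℝ, Complex.exp (-Real.pi * b * z ^ 2 + 2 * Real.pi * (-Complex.I * v) * z) * g z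
      = 1 / b ^ (1 / 2 : ℂ) *
        ∫ y : ℝ, Complex.exp (-Real.pi / b * (y + Complex.I * (-Complex.I * v)) ^ 2)
          * 𝓕⁻ g y := by
  have hslit : b ∈ Complex.slitPlane := by
    rw [Complex.mem_slitPlane_iff]
    rcases hb.lt_or_eq with h | h
    · exact .inl h
    · exact .inr fun him => hb0 (Complex.ext h.symm him)
  have hlim : Filter.Tendsto (fun ε : ℝ => b + ε) (𝓝[>] 0) (𝓝 b) := by
    have : Continuous fun ε : ℝ => b + ε := by fun_prop
    simpa using (this.tendsto 0).mono_left nhdsWithin_le_nhds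
  have hpos : ∀ᶠ ε : ℝ in 𝓝[>] 0, 0 < (b + ε).re := by
    filter_upwards [self_mem_nhdsWithin] with ε hε
    simpa using add_pos_of_nonneg_of_pos hb hε
  have hleft : Filter.Tendsto (fun ε : ℝ => ∫ z : ℝ,
      Complex.exp (-Real.pi * (b + ε) * z ^ 2 + 2 * Real.pi * (-Complex.I * v) * z) * g z)
      (𝓝[>] 0) (𝓝 (∫ z : ℝ,
        Complex.exp (-Real.pi * b * z ^ 2 + 2 * Real.pi * (-Complex.I * v) * z) * g z)) := by
    refine tendsto_integral_filter_of_dominated_convergence (fun z => ‖g z‖) ?_ ?_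
      g.integrable.norm ?_
    · refine Filter.Eventually.of_forall fun ε => Continuous.aestronglyMeasurable ?_
      have := g.continuous
      fun_prop
    · filter_upwards [hpos] with ε hε
      refine Filter.Eventually.of_forall fun z => ?_
      rw [norm_mul]
      exact mul_le_of_le_one_left (norm_nonneg _) (norm_cexp_neg_pi_mul_sq_add_le hε.le v z)
    · refine Filter.Eventually.of_forall fun z => Filter.Tendsto.mul_const _ ?_
      have : Continuous fun β : ℂ => Complex.exp
        (-Real.pi * β * z ^ 2 + 2 * Real.pi * (-Complex.I * v) * z) := by fun_prop
      exact (this.tendsto b).comp hlim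
  have hright : Filter.Tendsto (fun ε : ℝ => ∫ y : ℝ,
      Complex.exp (-Real.pi / (b + ε) * (y + Complex.I * (-Complex.I * v)) ^ 2) * 𝓕⁻ g y)
      (𝓝[>] 0) (𝓝 (∫ y : ℝ,
        Complex.exp (-Real.pi / b * (y + Complex.I * (-Complex.I * v)) ^ 2) * 𝓕⁻ g y)) := by
    refine tendsto_integral_filter_of_dominated_convergence (fun y => ‖𝓕⁻ g y‖) ?_ ?_
      (𝓕⁻ g).integrable.norm ?_
    · refine Filter.Eventually.of_forall fun ε => Continuous.aestronglyMeasurable ?_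
      have := (𝓕⁻ g).continuous
      fun_prop
    · filter_upwards [hpos] with ε hε
      refine Filter.Eventually.of_forall fun y => ?_
      rw [norm_mul]
      exact mul_le_of_le_one_left (norm_nonneg _) (norm_cexp_neg_pi_div_mul_sq_le hε.le v y)
    · refine Filter.Eventually.of_forall fun y => Filter.Tendsto.mul_const _ ?_
      exact (Complex.continuous_exp.tendsto _).comp
        ((tendsto_const_nhds.div hlim hb0).mul_const _)
  have hroot : Filter.Tendsto (fun ε : ℝ => 1 / (b + ε) ^ (1 / 2 : ℂ)) (𝓝[>] 0)
      (𝓝 (1 / b ^ (1 / 2 : ℂ))) :=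
    tendsto_const_nhds.div ((continuousAt_cpow_const hslit).tendsto.comp hlim)
      (by simp [Complex.cpow_eq_zero_iff, hb0])
  refine tendsto_nhds_unique hleft ((hroot.mul hright).congr' ?_)
  filter_upwards [hpos] with ε hε
  exact (integral_gaussian_mul_schwartz hε _ g).symm

theorem one_div_neg_two_mul_I_cpow_half :
    1 / (-2 * Complex.I) ^ (1 / 2 : ℂ)
      = Complex.exp (Complex.I * Real.pi / 4) / (Real.sqrt 2 : ℂ) := by
  have hsqrt : (Real.sqrt 2 : ℂ) = (2 : ℂ) ^ (1 / 2 : ℂ) := by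
    rw [Real.sqrt_eq_rpow, Complex.ofReal_cpow (by norm_num)]
    norm_num
  have hI : (-Complex.I) ^ (1 / 2 : ℂ) = Complex.exp (-(Complex.I * Real.pi / 4)) := by
    rw [Complex.cpow_def_of_ne_zero (by simp), Complex.log_neg_I]
    congr 1; ring
  have hmul : (-2 * Complex.I) ^ (1 / 2 : ℂ)
      = (2 : ℂ) ^ (1 / 2 : ℂ) * (-Complex.I) ^ (1 / 2 : ℂ) := by
    have hlog := Complex.log_ofReal_mul (r := 2) two_pos (x := -Complex.I) (by simp)
    rw [Complex.ofReal_log zero_le_two, Complex.ofReal_ofNat] at hlog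
    rw [neg_mul_comm, Complex.cpow_def_of_ne_zero (by simp), hlog, add_mul, Complex.exp_add,
      ← Complex.cpow_def_of_ne_zero (by simp), ← Complex.cpow_def_of_ne_zero (by simp)]
  rw [hmul, hI, hsqrt, Complex.exp_neg]
  field_simp

/-- Fresnel integral against a Schwartz function. -/
theorem integral_e_sq_sub_mul_schwartz (v : ℝ) (g : 𝓢(ℝ, ℂ)) :
    ∫ z : ℝ, e (z ^ 2 - v * z) * g z
      = Complex.exp (Complex.I * Real.pi / 4) / (Real.sqrt 2 : ℂ) *
        ∫ y : ℝ, e (-(((v + y) / 2) ^ 2)) * 𝓕⁻ g y := by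
  have h := integral_gaussian_mul_schwartz_of_re_nonneg (b := -2 * Complex.I) (by simp) (by simp)
    v g
  rw [one_div_neg_two_mul_I_cpow_half] at h
  convert h using 5 with z
  · simp only [e]
    congr 1; push_cast; ring
  · rename_i y
    simp only [e]
    congr 1
    rw [show (Complex.I * (-Complex.I * v) : ℂ) = v by rw [← mul_assoc]; simp]
    push_cast
    field_simp
    ring_nf
    simp only [Complex.I_sq]
    ring

theorem stmt7 (w : ℝ → ℂ) (hw : ContDiff ℝ (⊤ : ℕ∞) w) (hsupp : HasCompactSupport w)
    (Z : ℝ) (hZ : 0 < Z) (v : ℝ) :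
    Integrable (fun z : ℝ => e (z ^ 2 - v * z) * w (z / Z)) ∧
    Integrable (fun y : ℝ =>
      e (-(((v + y) / 2) ^ 2)) * ∫ t : ℝ, w t * e (-((-y * Z) * t))) ∧
    (∫ z : ℝ, e (z ^ 2 - v * z) * w (z / Z))
      = Complex.exp (Complex.I * Real.pi / 4) / (Real.sqrt 2 : ℂ) * (Z : ℂ) *
        ∫ y : ℝ, e (-(((v + y) / 2) ^ 2)) * ∫ t : ℝ, w t * e (-((-y * Z) * t)) := by
  have hZ0 : (Z : ℂ) ≠ 0 := by exact_mod_cast hZ.ne'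
  have hscale : HasCompactSupport fun z : ℝ => w (z / Z) := by
    simpa [div_eq_inv_mul] using hsupp.comp_smul (inv_ne_zero hZ.ne')
  have hsmooth : ContDiff ℝ (⊤ : ℕ∞) fun z : ℝ => w (z / Z) := hw.comp (by fun_prop)
  set g : 𝓢(ℝ, ℂ) := hscale.toSchwartzMap hsmooth
  have hg : ∀ z, g z = w (z / Z) := fun z => rfl
  have hinv : ∀ y, 𝓕⁻ g y = Z * ∫ t : ℝ, w t * e (-((-y * Z) * t)) := by
    intro y
    have h := Measure.integral_comp_div (fun t : ℝ => w t * e (-((-y * Z) * t))) Z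
    rw [abs_of_pos hZ, Complex.real_smul] at h
    rw [← h, SchwartzMap.fourierInv_coe, Real.fourierInv_eq']
    congr 1
    ext z
    rw [hg, smul_eq_mul, mul_comm, e]
    congr 2
    have : -((-y * Z) * (z / Z)) = y * z := by field_simp
    rw [this]
    simp
    ring
  have hinv' : ∀ y, ∫ t : ℝ, w t * e (-((-y * Z) * t)) = (Z : ℂ)⁻¹ * 𝓕⁻ g y := fun y => by
    rw [hinv, inv_mul_cancel_left₀ hZ0]
  refine ⟨integrable_e_comp_mul (by fun_prop) g.integrable, ?_, ?_⟩
  · simp_rw [hinv']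
    exact integrable_e_comp_mul (by fun_prop) ((𝓕⁻ g).integrable.const_mul _)
  · have h := integral_e_sq_sub_mul_schwartz v g
    simp_rw [hinv, mul_left_comm _ (Z : ℂ), integral_const_mul] at h
    rw [mul_assoc]
    exact h
end
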